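/- Let m ≥ 1 be an integer and α > 0. Suppose h : ℝ × [0,∞) → ℝ is a smooth global-in-time solution of the area-preserving (AP) support-function flow, 2mπ-periodic in θ, with h + h_θθ > 0 everywhere, whose initial algebraic area vanishes: A(0) = 0. Then the flow converges to a point and the curvature blows up at infinite time: lim_{t→∞} L(t) = 0 and sup_{θ ∈ ℝ, t ∈ [0,∞)} κ(θ,t) = +∞, where κ = (h + h_θθ)^{−1}. -/

import Mathlib

open Real MeasureTheory Filter

/-- Second derivative of the support function in the angle variable. -/
noncomputable def hpp (h : ℝ → ℝ → ℝ) (θ t : ℝ) : ℝ :=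
  iteratedDeriv 2 (fun x => h x t) θ

/-- Length of the evolving curve: `L(t) = ∫₀^{2mπ} h dθ`. -/
noncomputable def len (m : ℕ) (h : ℝ → ℝ → ℝ) (t : ℝ) : ℝ :=
  ∫ θ in (0:ℝ)..(2 * m * π), h θ t

/-- Algebraic area: `A(t) = (1/2)∫₀^{2mπ} h (h + h_θθ) dθ`. -/
noncomputable def area (m : ℕ) (h : ℝ → ℝ → ℝ) (t : ℝ) : ℝ :=
  (1 / 2) * ∫ θ in (0:ℝ)..(2 * m * π), h θ t * (h θ t + hpp h θ t)

/-- Nonlocal term of the area-preserving flow. -/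
noncomputable def lamAP (m : ℕ) (α : ℝ) (h : ℝ → ℝ → ℝ) (t : ℝ) : ℝ :=
  (∫ θ in (0:ℝ)..(2 * m * π), (h θ t + hpp h θ t) ^ (1 - α)) /
    (∫ θ in (0:ℝ)..(2 * m * π), h θ t)

lemma slice_deriv (h : ℝ → ℝ → ℝ)
    (hs : ContDiffOn ℝ (⊤ : ℕ∞) (Function.uncurry h) (Set.univ ×ˢ Set.Ici (0:ℝ))) :
    (∀ t, 0 ≤ t → ∀ x, HasDerivAt (fun y => h y t) (deriv (fun y => h y t) x) x) ∧
    ContDiffOn ℝ (⊤ : ℕ∞) (Function.uncurry (fun x t => deriv (fun y => h y t) x))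
      (Set.univ ×ˢ Set.Ici (0:ℝ)) := by
  have hU : UniqueDiffOn ℝ ((Set.univ : Set ℝ) ×ˢ Set.Ici (0:ℝ)) :=
    uniqueDiffOn_univ.prod (uniqueDiffOn_Ici 0)
  have key : ∀ t, 0 ≤ t → ∀ x, HasDerivAt (fun y => h y t)
      (fderivWithin ℝ (Function.uncurry h) (Set.univ ×ˢ Set.Ici (0:ℝ)) (x, t) (1, 0)) x := by
    intro t ht x
    have hmem : (x, t) ∈ (Set.univ : Set ℝ) ×ˢ Set.Ici (0:ℝ) := ⟨trivial, ht⟩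
    have h1 := (hs.differentiableOn (by simp) (x, t) hmem).hasFDerivWithinAt
    have h2 : HasDerivWithinAt (fun y : ℝ => (y, t)) ((1:ℝ), (0:ℝ)) Set.univ x :=
      ((hasDerivAt_id x).prodMk (hasDerivAt_const x t)).hasDerivWithinAt
    have h3 := HasFDerivWithinAt.comp_hasDerivWithinAt x (t := Set.univ ×ˢ Set.Ici (0:ℝ)) h1 h2
      (fun y _ => Set.mk_mem_prod trivial ht)
    exact (hasDerivWithinAt_univ.1 h3)
  refine ⟨fun t ht x => (key t ht x).differentiableAt.hasDerivAt, ?_⟩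
  have h4 : ContDiffOn ℝ (⊤ : ℕ∞)
      (fderivWithin ℝ (Function.uncurry h) (Set.univ ×ˢ Set.Ici (0:ℝ)))
      (Set.univ ×ˢ Set.Ici (0:ℝ)) := hs.fderivWithin hU (by simp)
  have h5 := h4.clm_apply (contDiffOn_const (c := ((1:ℝ), (0:ℝ))))
  refine h5.congr ?_
  rintro ⟨x, t⟩ ⟨_, ht⟩
  exact (key t ht x).deriv

lemma param_deriv (G : ℝ → ℝ → ℝ)
    (hG : ContDiffOn ℝ (⊤ : ℕ∞) (Function.uncurry G) (Set.univ ×ˢ Set.Ioi (0:ℝ)))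
    (P t : ℝ) (ht : 0 < t) :
    HasDerivAt (fun s => ∫ θ in (0:ℝ)..P, G θ s) (∫ θ in (0:ℝ)..P, deriv (fun s => G θ s) t) t := by
  have hO : IsOpen ((Set.univ : Set ℝ) ×ˢ Set.Ioi (0:ℝ)) := isOpen_univ.prod isOpen_Ioi
  have key : ∀ s, 0 < s → ∀ x, HasDerivAt (fun s => G x s)
      (fderiv ℝ (Function.uncurry G) (x, s) (0, 1)) s := by
    intro s hs x
    have h1 := ((hG.differentiableOn (by simp) (x, s) ⟨trivial, hs⟩).differentiableAt
      (hO.mem_nhds ⟨trivial, hs⟩)).hasFDerivAt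
    have h2 : HasDerivAt (fun y : ℝ => (x, y)) ((0:ℝ), (1:ℝ)) s :=
      ((hasDerivAt_const s x).prodMk (hasDerivAt_id s))
    exact HasFDerivAt.comp_hasDerivAt s h1 h2
  have hc : ContinuousOn (fun p : ℝ × ℝ => fderiv ℝ (Function.uncurry G) p (0, 1))
      (Set.univ ×ˢ Set.Ioi (0:ℝ)) :=
    (hG.continuousOn_fderiv_of_isOpen hO (by simp)).clm_apply continuousOn_const
  have hslice : ∀ s, 0 < s → Continuous (fun x => G x s) := by
    intro s hs
    exact hG.continuousOn.comp_continuous (f := fun x : ℝ => (x, s)) (by fun_prop)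
      (fun x => ⟨trivial, hs⟩)
  have hslice' : ∀ s, 0 < s → Continuous (fun x => fderiv ℝ (Function.uncurry G) (x, s) (0, 1)) := by
    intro s hs
    exact hc.comp_continuous (f := fun x : ℝ => (x, s)) (by fun_prop)
      (fun x => ⟨trivial, hs⟩)
  have hK : IsCompact (Set.uIcc 0 P ×ˢ Set.Icc (t/2) (2*t)) := isCompact_uIcc.prod isCompact_Icc
  obtain ⟨C, hC⟩ := hK.exists_bound_of_continuousOn (hc.mono (by
    rintro ⟨x, s⟩ ⟨_, hs⟩
    exact ⟨trivial, lt_of_lt_of_le (by positivity) hs.1⟩))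
  have hnb : Set.Icc (t/2) (2*t) ∈ nhds t := Icc_mem_nhds (by linarith) (by linarith)
  have := (intervalIntegral.hasDerivAt_integral_of_dominated_loc_of_deriv_le
    (μ := volume) (a := 0) (b := P) (x₀ := t) (F := fun s x => G x s)
    (F' := fun s x => fderiv ℝ (Function.uncurry G) (x, s) (0, 1)) (bound := fun _ => C) hnb
    (by
      filter_upwards [lt_mem_nhds ht] with s hs
      exact (hslice s hs).aestronglyMeasurable)
    ((hslice t ht).intervalIntegrable _ _)
    (hslice' t ht).aestronglyMeasurable
    (Eventually.of_forall fun x hx s hs => hC (x, s) ⟨Set.uIoc_subset_uIcc hx, hs⟩)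
    (by simp)
    (Eventually.of_forall fun x hx s hs => key s (lt_of_lt_of_le (by positivity) hs.1) x)).2
  have e : ∀ x, deriv (fun s => G x s) t = fderiv ℝ (Function.uncurry G) (x, t) (0, 1) :=
    fun x => (key t ht x).deriv
  simp_rw [e]
  exact this

lemma param_cont (G : ℝ → ℝ → ℝ)
    (hG : ContinuousOn (Function.uncurry G) (Set.univ ×ˢ Set.Ici (0:ℝ))) (P : ℝ) :
    ContinuousOn (fun s => ∫ θ in (0:ℝ)..P, G θ s) (Set.Ici 0) := by
  rw [continuousOn_iff_continuous_domRestrict]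
  refine intervalIntegral.continuous_parametric_intervalIntegral_of_continuous'
    (f := fun (s : Set.Ici (0:ℝ)) θ => G θ s) ?_ 0 P
  exact hG.comp_continuous (f := fun p : Set.Ici (0:ℝ) × ℝ => (p.2, (p.1 : ℝ))) (by fun_prop)
    (fun p => ⟨trivial, p.1.2⟩)

lemma sym_lem {f f' f'' g g' g'' : ℝ → ℝ} {P : ℝ}
    (hf : ∀ x, HasDerivAt f (f' x) x) (hf' : ∀ x, HasDerivAt f' (f'' x) x) (hf'' : Continuous f'')
    (hg : ∀ x, HasDerivAt g (g' x) x) (hg' : ∀ x, HasDerivAt g' (g'' x) x) (hg'' : Continuous g'')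
    (p1 : f P = f 0) (p2 : f' P = f' 0) (p3 : g P = g 0) (p4 : g' P = g' 0) :
    ∫ x in (0:ℝ)..P, f x * (g x + g'' x) = ∫ x in (0:ℝ)..P, g x * (f x + f'' x) := by
  have cf : Continuous f := continuous_iff_continuousAt.2 fun x => (hf x).continuousAt
  have cg : Continuous g := continuous_iff_continuousAt.2 fun x => (hg x).continuousAt
  rw [← sub_eq_zero, ← intervalIntegral.integral_sub
    (Continuous.intervalIntegrable (by fun_prop) _ _)
    (Continuous.intervalIntegrable (by fun_prop) _ _)]
  rw [intervalIntegral.integral_eq_sub_of_hasDerivAt (f := fun x => f x * g' x - g x * f' x)]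
  · simp only [p1, p2, p3, p4]; ring
  · intro x _
    refine HasDerivAt.congr_deriv (((hf x).mul (hg' x)).sub ((hg x).mul (hf' x))) ?_
    ring
  · exact Continuous.intervalIntegrable (by fun_prop) _ _

/-- Zero area forces an L1 deviation of the radius of curvature from its mean. -/
lemma static_dev {f f' f'' : ℝ → ℝ} {P c : ℝ} (hP : 0 ≤ P)
    (hf : ∀ x, HasDerivAt f (f' x) x) (hf' : ∀ x, HasDerivAt f' (f'' x) x) (hf'' : Continuous f'')
    (p1 : f P = f 0) (p2 : f' P = f' 0) (hcos : cos P = 1) (hsin : sin P = 0)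
    (hc : ∫ x in (0:ℝ)..P, f x = P * c)
    (hA : ∫ x in (0:ℝ)..P, f x * (f x + f'' x) = 0) :
    P * c ^ 2 ≤ (∫ x in (0:ℝ)..P, |f x + f'' x - c|) ^ 2 := by
  have cf : Continuous f := continuous_iff_continuousAt.2 fun x => (hf x).continuousAt
  have cf' : Continuous f' := continuous_iff_continuousAt.2 fun x => (hf' x).continuousAt
  set k : ℝ → ℝ := fun x => f x + f'' x - c with hk
  have ck : Continuous k := by fun_prop
  set N := ∫ x in (0:ℝ)..P, |k x| with hN
  have II : ∀ {u : ℝ → ℝ}, Continuous u → ∀ a b, IntervalIntegrable u volume a b :=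
    fun hu a b => hu.intervalIntegrable a b
  have hk0 : ∫ x in (0:ℝ)..P, k x = 0 := by
    have e1 : ∫ x in (0:ℝ)..P, f'' x = 0 := by
      rw [intervalIntegral.integral_eq_sub_of_hasDerivAt (fun x _ => hf' x) (II hf'' _ _), p2, sub_self]
    simp only [hk]
    rw [intervalIntegral.integral_sub (II (by fun_prop) _ _) (II (by fun_prop) _ _),
      intervalIntegral.integral_add (II cf _ _) (II hf'' _ _), e1, hc]
    simp
  have hkc : ∫ x in (0:ℝ)..P, cos x * k x = 0 := by
    rw [intervalIntegral.integral_eq_sub_of_hasDerivAt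
      (f := fun x => cos x * f' x + sin x * (f x - c)) _ (II (by fun_prop) _ _)]
    · simp [hcos, hsin, p2]
    · intro x _
      refine HasDerivAt.congr_deriv (((hasDerivAt_cos x).mul (hf' x)).add ((hasDerivAt_sin x).mul ((hf x).sub_const c))) ?_
      simp only [hk]; ring
  have hks : ∫ x in (0:ℝ)..P, sin x * k x = 0 := by
    rw [intervalIntegral.integral_eq_sub_of_hasDerivAt
      (f := fun x => sin x * f' x - cos x * (f x - c)) _ (II (by fun_prop) _ _)]
    · simp [hcos, hsin, p1]
    · intro x _
      refine HasDerivAt.congr_deriv (((hasDerivAt_sin x).mul (hf' x)).sub ((hasDerivAt_cos x).mul ((hf x).sub_const c))) ?_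
      simp only [hk]; ring
  set a := f 0 - c
  set b := f' 0
  set g : ℝ → ℝ := fun x => f x - c - a * cos x - b * sin x with hg
  have cg : Continuous g := by fun_prop
  have hgk : ∫ x in (0:ℝ)..P, g x * k x = - (P * c ^ 2) := by
    have e : ∀ x, g x * k x = f x * (f x + f'' x) - c * f x - c * k x - a * (cos x * k x)
        - b * (sin x * k x) := by
      intro x; simp only [hg, hk]; ring
    simp_rw [e]
    rw [intervalIntegral.integral_sub (II (by fun_prop) _ _) (II (by fun_prop) _ _),
      intervalIntegral.integral_sub (II (by fun_prop) _ _) (II (by fun_prop) _ _),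
      intervalIntegral.integral_sub (II (by fun_prop) _ _) (II (by fun_prop) _ _),
      intervalIntegral.integral_sub (II (by fun_prop) _ _) (II (by fun_prop) _ _)]
    simp only [intervalIntegral.integral_const_mul, hA, hc, hk0, hkc, hks]
    ring
  have hgb : ∀ x ∈ Set.Icc 0 P, |g x| ≤ N := by
    intro x hx
    have e : g x = ∫ s in (0:ℝ)..x, sin (x - s) * k s := by
      rw [intervalIntegral.integral_eq_sub_of_hasDerivAt
        (f := fun s => sin (x - s) * f' s + cos (x - s) * (f s - c)) _ (II (by fun_prop) _ _)]
      · simp [hg, a, b]; ring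
      · intro s _
        have d0 : HasDerivAt (fun s => x - s) (-1) s := by
          simpa using (hasDerivAt_id s).const_sub x
        refine HasDerivAt.congr_deriv ((d0.sin.mul (hf' s)).add (d0.cos.mul ((hf s).sub_const c))) ?_
        simp only [hk]; ring
    rw [e]
    calc |∫ s in (0:ℝ)..x, sin (x - s) * k s| ≤ ∫ s in (0:ℝ)..x, |sin (x - s) * k s| :=
          intervalIntegral.abs_integral_le_integral_abs hx.1
      _ ≤ ∫ s in (0:ℝ)..x, |k s| := by
          apply intervalIntegral.integral_mono_on hx.1 (II (by fun_prop) _ _) (II (by fun_prop) _ _)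
          intro s _
          rw [abs_mul]
          exact mul_le_of_le_one_left (abs_nonneg _) (abs_sin_le_one _)
      _ ≤ N := by
          apply intervalIntegral.integral_mono_interval le_rfl hx.1 hx.2
            (Eventually.of_forall fun s => abs_nonneg _) (II (by fun_prop) _ _)
  have hfin : |∫ x in (0:ℝ)..P, g x * k x| ≤ N * N := by
    calc |∫ x in (0:ℝ)..P, g x * k x| ≤ ∫ x in (0:ℝ)..P, |g x * k x| :=
          intervalIntegral.abs_integral_le_integral_abs hP
      _ ≤ ∫ x in (0:ℝ)..P, N * |k x| := by
          apply intervalIntegral.integral_mono_on hP (II (by fun_prop) _ _) (II (by fun_prop) _ _)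
          intro s hs
          rw [abs_mul]
          exact mul_le_mul_of_nonneg_right (hgb s hs) (abs_nonneg _)
      _ = N * N := by rw [intervalIntegral.integral_const_mul]
  rw [hgk, abs_neg] at hfin
  calc P * c ^ 2 ≤ |P * c ^ 2| := le_abs_self _
    _ ≤ N * N := hfin
    _ = N ^ 2 := by ring

lemma pointwise {α c r : ℝ} (hα : 0 < α) (hc : 0 < c) (hr : 0 < r) :
    α * c ^ (-α) / c * (max (c - r) 0) ^ 2 ≤ (c - r) * (r ^ (-α) - c ^ (-α)) := by
  have hb : c ^ (-α) * (1 - α * (r / c - 1)) ≤ r ^ (-α) := by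
    have hx : 0 < r / c := by positivity
    have e : r ^ (-α) = c ^ (-α) * (r / c) ^ (-α) := by
      rw [← mul_rpow hc.le hx.le]; congr 1; field_simp
    rw [e]
    apply mul_le_mul_of_nonneg_left _ (by positivity)
    rw [rpow_def_of_pos hx]
    have h1 := add_one_le_exp (log (r / c) * -α)
    have h2 := log_le_sub_one_of_pos hx
    nlinarith
  rcases le_total r c with h | h
  · rw [max_eq_left (by linarith)]
    have h3 : α * c ^ (-α) / c * (c - r) ≤ r ^ (-α) - c ^ (-α) := by
      have : α * c ^ (-α) / c * (c - r) = c ^ (-α) * (1 - α * (r / c - 1)) - c ^ (-α) := by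
        field_simp; ring
      linarith
    nlinarith [mul_le_mul_of_nonneg_left h3 (sub_nonneg.2 h)]
  · rw [max_eq_right (by linarith)]
    have h3 : r ^ (-α) ≤ c ^ (-α) := rpow_le_rpow_of_nonpos hc h (by linarith)
    nlinarith

/-- Dissipation estimate. -/
lemma static_diss {α P c : ℝ} {r : ℝ → ℝ} (hα : 0 < α) (hP : 0 < P) (hc : 0 < c)
    (cr : Continuous r) (hr : ∀ x, 0 < r x)
    (hmean : ∫ x in (0:ℝ)..P, r x = P * c)
    (hdev : P * c ^ 2 ≤ (∫ x in (0:ℝ)..P, |r x - c|) ^ 2) :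
    ∫ x in (0:ℝ)..P, (-(r x) ^ (-α) + (∫ y in (0:ℝ)..P, (r y) ^ (1 - α)) / (P * c))
      ≤ - (α / 4 * c ^ (-α)) := by
  have II : ∀ {u : ℝ → ℝ}, Continuous u → ∀ a b, IntervalIntegrable u volume a b :=
    fun hu a b => hu.intervalIntegrable a b
  have cra : ∀ q : ℝ, Continuous fun x => (r x) ^ q := fun q =>
    cr.rpow_const fun x => Or.inl (hr x).ne'
  have c1 := cra (-α)
  have c2 := cra (1 - α)
  set y : ℝ → ℝ := fun x => max (c - r x) 0 with hy
  have cy : Continuous y := by fun_prop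
  set Y := ∫ x in (0:ℝ)..P, y x with hY
  have hNY : ∫ x in (0:ℝ)..P, |r x - c| = 2 * Y := by
    have e : ∀ x, |r x - c| = 2 * y x + (r x - c) := by
      intro x
      simp only [hy]
      rcases le_total (r x) c with h | h
      · rw [max_eq_left (by linarith), abs_of_nonpos (by linarith)]; ring
      · rw [max_eq_right (by linarith), abs_of_nonneg (by linarith)]; ring
    simp_rw [e]
    rw [intervalIntegral.integral_add (II (by fun_prop) _ _) (II (by fun_prop) _ _),
      intervalIntegral.integral_sub (II (by fun_prop) _ _) (II (by fun_prop) _ _),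
      intervalIntegral.integral_const_mul, hmean]
    simp [hY]
  have hCS : Y ^ 2 / P ≤ ∫ x in (0:ℝ)..P, (y x) ^ 2 := by
    have : ∫ x in (0:ℝ)..P, (2 * (Y / P) * y x - (Y / P) ^ 2) ≤ ∫ x in (0:ℝ)..P, (y x) ^ 2 := by
      apply intervalIntegral.integral_mono_on hP.le (II (by fun_prop) _ _) (II (by fun_prop) _ _)
      intro x _
      nlinarith [sq_nonneg (y x - Y / P)]
    rw [intervalIntegral.integral_sub (II (by fun_prop) _ _) (II (by fun_prop) _ _),
      intervalIntegral.integral_const_mul, ← hY] at this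
    simp only [intervalIntegral.integral_const, smul_eq_mul, sub_zero] at this
    refine le_trans (le_of_eq ?_) this
    field_simp; ring
  have hD : α * c ^ (-α) / c * ∫ x in (0:ℝ)..P, (y x) ^ 2
      ≤ ∫ x in (0:ℝ)..P, (c - r x) * ((r x) ^ (-α) - c ^ (-α)) := by
    rw [← intervalIntegral.integral_const_mul]
    apply intervalIntegral.integral_mono_on hP.le (II (by fun_prop) _ _) (II (by fun_prop) _ _)
    intro x _
    exact pointwise hα hc (hr x)
  have hE : ∫ x in (0:ℝ)..P, (c - r x) * ((r x) ^ (-α) - c ^ (-α))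
      = c * (∫ x in (0:ℝ)..P, (r x) ^ (-α)) - ∫ x in (0:ℝ)..P, (r x) ^ (1 - α) := by
    have e : ∀ x, (c - r x) * ((r x) ^ (-α) - c ^ (-α)) =
        c * (r x) ^ (-α) - (r x) ^ (1 - α) - (c ^ (-α) * c - c ^ (-α) * r x) := by
      intro x
      have : (r x) ^ (1 - α) = r x * (r x) ^ (-α) := by
        rw [sub_eq_add_neg, rpow_add (hr x), rpow_one]
      rw [this]; ring
    simp_rw [e]
    rw [intervalIntegral.integral_sub (II (by fun_prop) _ _) (II (by fun_prop) _ _),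
      intervalIntegral.integral_sub (II (by fun_prop) _ _) (II (by fun_prop) _ _),
      intervalIntegral.integral_sub (II (by fun_prop) _ _) (II (by fun_prop) _ _),
      intervalIntegral.integral_const_mul, intervalIntegral.integral_const_mul,
      intervalIntegral.integral_const_mul, hmean]
    simp only [intervalIntegral.integral_const, smul_eq_mul, sub_zero]; ring
  rw [intervalIntegral.integral_add (II (by fun_prop) _ _) (II (by fun_prop) _ _),
    intervalIntegral.integral_neg]
  simp only [intervalIntegral.integral_const, smul_eq_mul, sub_zero]
  rw [hNY] at hdev
  rw [hE] at hD
  set I1 := ∫ x in (0:ℝ)..P, (r x) ^ (-α)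
  set I2 := ∫ x in (0:ℝ)..P, (r x) ^ (1 - α)
  have hca : 0 < c ^ (-α) := by positivity
  have h6 : c ^ 2 / 4 ≤ Y ^ 2 / P := by
    rw [le_div_iff₀ hP]; nlinarith
  have h7 : α * c ^ (-α) / c * (c ^ 2 / 4) ≤ c * I1 - I2 :=
    (mul_le_mul_of_nonneg_left (h6.trans hCS) (by positivity)).trans hD
  have h8 : α * c ^ (-α) / c * (c ^ 2 / 4) = c * (α / 4 * c ^ (-α)) := by field_simp
  rw [h8] at h7
  have h9 : c * (-I1 + P * (I2 / (P * c))) = -(c * I1 - I2) := by field_simp; ring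
  have : c * (-I1 + P * (I2 / (P * c))) ≤ c * (-(α / 4 * c ^ (-α))) := by rw [h9]; linarith
  exact le_of_mul_le_mul_left this hc

/-- If the AP support-function flow has a smooth global-in-time solution whose initial
algebraic area vanishes, then the flow shrinks to a point (`L(t) → 0`) and the curvature
`κ = (h + h_θθ)⁻¹` is unbounded on `ℝ × [0,∞)`. -/
theorem ap_global_zero_area_converges_to_point
    (m : ℕ) (hm : 1 ≤ m) (α : ℝ) (hα : 0 < α) (h : ℝ → ℝ → ℝ)
    (hsmooth : ContDiffOn ℝ (⊤ : ℕ∞) (Function.uncurry h) (Set.univ ×ˢ Set.Ici (0:ℝ)))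
    (hper : ∀ θ t, 0 ≤ t → h (θ + 2 * m * π) t = h θ t)
    (hconv : ∀ θ t, 0 ≤ t → 0 < h θ t + hpp h θ t)
    (hflow : ∀ θ t, 0 ≤ t →
      derivWithin (fun s => h θ s) (Set.Ici 0) t
        = -(h θ t + hpp h θ t) ^ (-α) + lamAP m α h t)
    (harea : area m h 0 = 0) :
    Tendsto (len m h) atTop (nhds 0) ∧
      ∀ M : ℝ, ∃ θ t, 0 ≤ t ∧ M < (h θ t + hpp h θ t)⁻¹ := by
  exfalso
  set P : ℝ := 2 * m * π with hPdef
  have hP : 0 < P := by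
    have : (0:ℝ) < m := by exact_mod_cast hm
    positivity
  have hcos : cos P = 1 := by
    rw [hPdef, show (2:ℝ) * m * π = m * (2 * π) by ring]; exact cos_nat_mul_two_pi m
  have hsin : sin P = 0 := by
    rw [hPdef, show (2:ℝ) * m * π = ((2 * m : ℕ) : ℝ) * π by push_cast; ring]
    exact sin_nat_mul_pi _
  have II : ∀ {u : ℝ → ℝ}, Continuous u → ∀ a b, IntervalIntegrable u volume a b :=
    fun hu a b => hu.intervalIntegrable a b
  obtain ⟨d1, s1⟩ := slice_deriv h hsmooth
  obtain ⟨d2, s2⟩ := slice_deriv _ s1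
  have hpp_eq : (fun x t => deriv (fun y => deriv (fun z => h z t) y) x) = hpp h := by
    funext x t
    simp only [hpp, iteratedDeriv_succ, iteratedDeriv_zero]
  have hppx : ∀ x t, deriv (fun y => deriv (fun z => h z t) y) x = hpp h x t :=
    fun x t => congrFun (congrFun hpp_eq x) t
  rw [hpp_eq] at s2
  simp only [hppx] at d2
  have slc : ∀ {G : ℝ → ℝ → ℝ},
      ContDiffOn ℝ (⊤ : ℕ∞) (Function.uncurry G) (Set.univ ×ˢ Set.Ici (0:ℝ)) →
      ∀ t, 0 ≤ t → Continuous (fun x => G x t) := by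
    intro G hG t ht
    exact hG.continuousOn.comp_continuous (f := fun x : ℝ => (x, t)) (by fun_prop)
      (fun x => ⟨trivial, ht⟩)
  have ch := slc hsmooth
  have chp := slc s2
  have p1 : ∀ t, 0 ≤ t → h P t = h 0 t := by
    intro t ht; simpa using hper 0 t ht
  have p2 : ∀ t, 0 ≤ t → deriv (fun y => h y t) P = deriv (fun y => h y t) 0 := by
    intro t ht
    have e : (fun y => h (y + P) t) = fun y => h y t := funext fun y => hper y t ht
    have := deriv_comp_add_const (fun y => h y t) P 0
    rw [e] at this
    simpa using this.symm
  have sub : (Set.univ : Set ℝ) ×ˢ Set.Ioi (0:ℝ) ⊆ Set.univ ×ˢ Set.Ici (0:ℝ) :=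
    Set.prod_mono le_rfl Set.Ioi_subset_Ici_self
  have tdiff : ∀ {G : ℝ → ℝ → ℝ},
      ContDiffOn ℝ (⊤ : ℕ∞) (Function.uncurry G) (Set.univ ×ˢ Set.Ici (0:ℝ)) →
      ∀ t, 0 < t → ∀ x, DifferentiableAt ℝ (fun s => G x s) t := by
    intro G hG t ht x
    have hO : IsOpen ((Set.univ : Set ℝ) ×ˢ Set.Ioi (0:ℝ)) := isOpen_univ.prod isOpen_Ioi
    have h1 := ((hG.mono sub).differentiableOn (by simp) (x, t) ⟨trivial, ht⟩).differentiableAt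
      (hO.mem_nhds ⟨trivial, ht⟩)
    exact DifferentiableAt.comp (g := Function.uncurry G) (f := fun s : ℝ => (x, s)) t h1 (by fun_prop)
  have flow' : ∀ t, 0 < t → ∀ x, deriv (fun s => h x s) t
      = -(h x t + hpp h x t) ^ (-α) + lamAP m α h t := by
    intro t ht x
    rw [← hflow x t ht.le, derivWithin_of_mem_nhds (Ici_mem_nhds ht)]
  have hint : ∀ t, 0 ≤ t → ∫ x in (0:ℝ)..P, (h x t + hpp h x t) = len m h t := by
    intro t ht
    have e1 : ∫ x in (0:ℝ)..P, hpp h x t = 0 := by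
      rw [intervalIntegral.integral_eq_sub_of_hasDerivAt (fun x _ => d2 t ht x) (II (chp t ht) _ _),
        p2 t ht, sub_self]
    rw [intervalIntegral.integral_add (II (ch t ht) _ _) (II (chp t ht) _ _), e1, add_zero]
    rfl
  have Lpos : ∀ t, 0 ≤ t → 0 < len m h t := by
    intro t ht
    rw [← hint t ht]
    exact intervalIntegral.intervalIntegral_pos_of_pos (II ((ch t ht).add (chp t ht)) _ _)
      (fun x => hconv x t ht) hP
  have Lder : ∀ t, 0 < t → HasDerivAt (len m h)
      (∫ x in (0:ℝ)..P, (-(h x t + hpp h x t) ^ (-α) + lamAP m α h t)) t := by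
    intro t ht
    have := param_deriv h (hsmooth.mono sub) P t ht
    simp only [flow' t ht] at this
    exact this
  have Lcont : ContinuousOn (len m h) (Set.Ici 0) := param_cont h hsmooth.continuousOn P
  have Acont : ContinuousOn (area m h) (Set.Ici 0) := by
    refine continuousOn_const.mul (param_cont (fun x t => h x t * (h x t + hpp h x t)) ?_ P)
    exact hsmooth.continuousOn.mul (hsmooth.continuousOn.add s2.continuousOn)
  have cra : ∀ q t : ℝ, 0 ≤ t → Continuous fun x => (h x t + hpp h x t) ^ q := fun q t ht =>
    ((ch t ht).add (chp t ht)).rpow_const fun x => Or.inl (hconv x t ht).ne'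
  have Ader : ∀ t, 0 < t → HasDerivAt (area m h) 0 t := by
    intro t ht
    set G : ℝ → ℝ → ℝ := fun x s =>
      (h x s - h x t) * ((h x s + hpp h x s) + (h x t + hpp h x t)) with hG
    have proj : ∀ {F : ℝ → ℝ → ℝ},
      ContDiffOn ℝ (⊤ : ℕ∞) (Function.uncurry F) (Set.univ ×ˢ Set.Ici (0:ℝ)) →
      ContDiffOn ℝ (⊤ : ℕ∞) (fun p : ℝ × ℝ => F p.1 t) (Set.univ ×ˢ Set.Ici (0:ℝ)) := by
      intro F hF
      exact hF.comp (f := fun p : ℝ × ℝ => (p.1, t)) (by fun_prop) (fun p _ => ⟨trivial, ht.le⟩)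
    have Gs : ContDiffOn ℝ (⊤ : ℕ∞) (Function.uncurry G) (Set.univ ×ˢ Set.Ici (0:ℝ)) :=
      (hsmooth.sub (proj hsmooth)).mul ((hsmooth.add s2).add ((proj hsmooth).add (proj s2)))
    have Gd := param_deriv G (Gs.mono sub) P t ht
    have Gt : ∀ x, deriv (fun s => G x s) t = 2 * (-(h x t + hpp h x t) ^ (1 - α)
        + lamAP m α h t * (h x t + hpp h x t)) := by
      intro x
      have a1 := (tdiff hsmooth t ht x).hasDerivAt
      have a2 := (tdiff s2 t ht x).hasDerivAt
      have a3 := (a1.sub_const (h x t)).mul ((a1.add a2).add_const (h x t + hpp h x t))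
      refine (HasDerivAt.deriv (f := fun s => G x s) a3).trans ?_
      have : (h x t + hpp h x t) ^ (1 - α) = (h x t + hpp h x t) * (h x t + hpp h x t) ^ (-α) := by
        rw [sub_eq_add_neg, rpow_add (hconv x t ht.le), rpow_one]
      rw [flow' t ht x, this]
      simp only [Pi.add_apply]
      ring
    simp only [Gt] at Gd
    have z : ∫ x in (0:ℝ)..P, 2 * (-(h x t + hpp h x t) ^ (1 - α)
        + lamAP m α h t * (h x t + hpp h x t)) = 0 := by
      have j1 := cra (1 - α) t ht.le
      have j2 := ch t ht.le
      have j3 := chp t ht.le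
      rw [intervalIntegral.integral_const_mul, intervalIntegral.integral_add
        (II (by fun_prop) _ _) (II (by fun_prop) _ _),
        intervalIntegral.integral_const_mul, intervalIntegral.integral_neg, hint t ht.le]
      have : lamAP m α h t * len m h t = ∫ x in (0:ℝ)..P, (h x t + hpp h x t) ^ (1 - α) :=
        div_mul_cancel₀ _ (Lpos t ht.le).ne'
      rw [this]; ring
    rw [z] at Gd
    have Gd2 := (Gd.const_mul (1/2)).const_add (area m h t)
    simp only [mul_zero] at Gd2
    refine Gd2.congr_of_eventuallyEq ?_
    filter_upwards [lt_mem_nhds ht] with s hs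
    have sy := sym_lem (d1 s hs.le) (d2 s hs.le) (chp s hs.le) (d1 t ht.le) (d2 t ht.le) (chp t ht.le)
      (p1 s hs.le) (p2 s hs.le) (p1 t ht.le) (p2 t ht.le)
    have i1 := ch s hs.le
    have i2 := chp s hs.le
    have i3 := ch t ht.le
    have i4 := chp t ht.le
    have e : ∀ x, G x s = h x s * (h x s + hpp h x s) + h x s * (h x t + hpp h x t)
        - h x t * (h x s + hpp h x s) - h x t * (h x t + hpp h x t) := by
      intro x; simp only [hG]; ring
    simp only [area, e]
    rw [← hPdef, intervalIntegral.integral_sub (II (by fun_prop) _ _) (II (by fun_prop) _ _),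
      intervalIntegral.integral_sub (II (by fun_prop) _ _) (II (by fun_prop) _ _),
      intervalIntegral.integral_add (II (by fun_prop) _ _) (II (by fun_prop) _ _), sy]
    ring
  have A0 : ∀ t, 0 ≤ t → area m h t = 0 := by
    intro t ht
    rcases ht.eq_or_lt with rfl | ht
    · exact harea
    obtain ⟨ξ, hξ, e⟩ := exists_hasDerivAt_eq_slope (area m h) (fun _ => 0) ht
      (Acont.mono Set.Icc_subset_Ici_self) (fun x hx => Ader x hx.1)
    rw [harea, sub_zero, sub_zero, eq_comm, div_eq_zero_iff] at e
    rcases e with e | e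
    · exact e
    · exact absurd e ht.ne'
  have Lineq : ∀ t, 0 < t → ∫ x in (0:ℝ)..P, (-(h x t + hpp h x t) ^ (-α) + lamAP m α h t)
      ≤ - (α / 4 * (len m h t / P) ^ (-α)) := by
    intro t ht
    have hL := Lpos t ht.le
    have hc : 0 < len m h t / P := by positivity
    have hPc : P * (len m h t / P) = len m h t := by field_simp
    have hA : ∫ x in (0:ℝ)..P, h x t * (h x t + hpp h x t) = 0 := by
      have := A0 t ht.le
      simp only [area] at this
      rw [← hPdef] at this
      linarith
    have dev := static_dev (c := len m h t / P) hP.le (d1 t ht.le) (d2 t ht.le) (chp t ht.le)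
      (p1 t ht.le) (p2 t ht.le) hcos hsin (by rw [hPc]; rfl) hA
    have := static_diss hα hP hc ((ch t ht.le).add (chp t ht.le)) (fun x => hconv x t ht.le)
      (by rw [hPc]; exact hint t ht.le) dev
    rw [hPc] at this
    exact this
  set K : ℝ := (α + 1) * (α / 4 * (P⁻¹) ^ (-α)) with hK
  have Kpos : 0 < K := by positivity
  set u : ℝ → ℝ := fun t => (len m h t) ^ (α + 1) + K * t with hu
  have uder : ∀ t, 0 < t → HasDerivAt u
      ((∫ x in (0:ℝ)..P, (-(h x t + hpp h x t) ^ (-α) + lamAP m α h t)) * (α + 1) *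
        (len m h t) ^ (α + 1 - 1) + K * 1) t := by
    intro t ht
    exact ((Lder t ht).rpow_const (Or.inl (Lpos t ht.le).ne')).add ((hasDerivAt_id t).const_mul K)
  have anti : AntitoneOn u (Set.Ici 0) := by
    refine antitoneOn_of_deriv_nonpos (convex_Ici 0) ?_ ?_ ?_
    · exact (Lcont.rpow_const fun x hx => Or.inl (Lpos x hx).ne').add (by fun_prop)
    · rw [interior_Ici]
      exact fun t ht => (uder t ht).differentiableAt.differentiableWithinAt
    · rw [interior_Ici]
      intro t ht
      rw [(uder t ht).deriv]
      have hL := Lpos t (le_of_lt ht)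
      have i := Lineq t ht
      rw [add_sub_cancel_right]
      have e1 : (len m h t / P) ^ (-α) = (len m h t) ^ (-α) * (P⁻¹) ^ (-α) := by
        rw [div_eq_mul_inv, mul_rpow hL.le (by positivity)]
      have e2 : (len m h t) ^ (-α) * (len m h t) ^ α = 1 := by
        rw [← rpow_add hL]; simp
      have i2 := mul_le_mul_of_nonneg_right i
        (show 0 ≤ (α + 1) * (len m h t) ^ α by positivity)
      have e3 : -(α / 4 * (len m h t / P) ^ (-α)) * ((α + 1) * (len m h t) ^ α) = -K := by
        rw [e1, hK]
        linear_combination (-(α / 4 * (P⁻¹) ^ (-α) * (α + 1))) * e2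
      rw [e3] at i2
      linarith
  have hT : 0 ≤ (len m h 0) ^ (α + 1) / K :=
    div_nonneg (rpow_nonneg (Lpos 0 le_rfl).le _) Kpos.le
  have fin := anti (Set.mem_Ici.2 le_rfl) (Set.mem_Ici.2 hT) hT
  simp only [hu, mul_zero, add_zero, mul_div_cancel₀ _ Kpos.ne'] at fin
  have := rpow_pos_of_pos (Lpos _ hT) (α + 1)
  have e4 : K * ((len m h 0) ^ (α + 1) / K) = (len m h 0) ^ (α + 1) := by field_simp
  linarith
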